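/- Let E be a real Hilbert space, A : E → E a bounded self-adjoint operator (⟨Au,v⟩ = ⟨u,Av⟩ for all u,v) with finite-dimensional kernel, and w ∈ E. Let ℓ : E → ℝ be the continuous linear functional ℓ(v) := −⟨Aw,v⟩, set H := ker ℓ, H⊥ := { u ∈ E : ⟨Au,v⟩ = 0 for all v ∈ H }, a := ℓ(w) = −⟨Aw,w⟩, and 𝔫 := m⁻((u,v) ↦ ⟨Au,v⟩ restricted to H⊥) + dim(H ∩ H⊥) − dim(H ∩ ker A). Then: (i) if ℓ ≠ 0 and a = 0 then 𝔫 = 1; (ii) in all cases 𝔫 ≥ m⁺(a), where m⁺(a) = 1 if a > 0 and m⁺(a) = 0 otherwise. -/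

import Mathlib

open scoped RealInnerProductSpace

variable {E : Type*} [NormedAddCommGroup E] [InnerProductSpace ℝ E] [CompleteSpace E]

/-- The Morse index of a bilinear form `B` restricted to a subspace `S`: the supremum (in
`ℕ∞`) of the dimensions of finite-dimensional subspaces of `S` on which `B` is negative
definite. -/
noncomputable def morseIndexOn {F : Type*} [AddCommGroup F] [Module ℝ F]
    (B : F → F → ℝ) (S : Submodule ℝ F) : ℕ∞ :=
  sSup {d : ℕ∞ | ∃ W : Submodule ℝ F, W ≤ S ∧ FiniteDimensional ℝ W ∧
    (Module.finrank ℝ W : ℕ∞) = d ∧ ∀ u ∈ W, u ≠ 0 → B u u < 0}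

/-- The linear functional `ℓ(v) = −⟨Aw, v⟩`. -/
noncomputable def ellFunctional (A : E →L[ℝ] E) (w : E) : E →L[ℝ] ℝ :=
  -(InnerProductSpace.toDual ℝ E (A w) : E →L[ℝ] ℝ)

/-- The subspace `H⊥ = { u | ⟨Au, v⟩ = 0 for all v ∈ H }` of vectors `A`-orthogonal to a
subspace `H`. -/
def aOrthogonal (A : E →L[ℝ] E) (H : Submodule ℝ E) : Submodule ℝ E where
  carrier := {u | ∀ v ∈ H, ⟪A u, v⟫ = 0}
  add_mem' := by
    intro a b ha hb v hv
    rw [map_add, inner_add_left, ha v hv, hb v hv, add_zero]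
  zero_mem' := by
    intro v hv
    rw [map_zero, inner_zero_left]
  smul_mem' := by
    intro c a ha v hv
    rw [map_smul, real_inner_smul_left, ha v hv, mul_zero]

/-- The `{0,1}`-valued correction term
`𝔫 = m⁻(⟨A·,·⟩|_{H⊥}) + dim(H ∩ H⊥) − dim(H ∩ ker A)`. -/
noncomputable def nCorrection (A : E →L[ℝ] E) (w : E) : ℕ∞ :=
  morseIndexOn (fun u v => ⟪A u, v⟫)
      (aOrthogonal A (LinearMap.ker (ellFunctional A w : E →ₗ[ℝ] ℝ)))
    + (Module.finrank ℝ
        ↥(LinearMap.ker (ellFunctional A w : E →ₗ[ℝ] ℝ) ⊓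
            aOrthogonal A (LinearMap.ker (ellFunctional A w : E →ₗ[ℝ] ℝ))) : ℕ∞)
    - (Module.finrank ℝ
        ↥(LinearMap.ker (ellFunctional A w : E →ₗ[ℝ] ℝ) ⊓ LinearMap.ker (A : E →ₗ[ℝ] E)) : ℕ∞)

theorem mem_ker_ell (A : E →L[ℝ] E) (w v : E) :
    v ∈ LinearMap.ker (ellFunctional A w : E →ₗ[ℝ] ℝ) ↔ ⟪A w, v⟫ = 0 := by
  simp [ellFunctional]

theorem aOrth_eq (A : E →L[ℝ] E) (w : E) :
    aOrthogonal A (LinearMap.ker (ellFunctional A w : E →ₗ[ℝ] ℝ)) =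
      Submodule.span ℝ {w} ⊔ LinearMap.ker (A : E →ₗ[ℝ] E) := by
  ext u
  rw [Submodule.mem_sup]
  constructor
  · intro hu
    set c : ℝ := ⟪A w, A u⟫ / ⟪A w, A w⟫ with hc
    have h1 : ⟪A w, A u - c • A w⟫ = 0 := by
      rw [inner_sub_right, real_inner_smul_right]
      by_cases h : A w = 0
      · simp [h]
      · have : ⟪A w, A w⟫ ≠ 0 := by simpa using h
        rw [hc]
        field_simp
        ring
    have h2 : ⟪A u, A u - c • A w⟫ = 0 := hu _ ((mem_ker_ell A w _).2 h1)
    have h3 : ⟪A u - c • A w, A u - c • A w⟫ = 0 := by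
      rw [inner_sub_left, h2, real_inner_smul_left, h1]
      simp
    have h4 : A u - c • A w = 0 := by simpa using h3
    refine ⟨c • w, Submodule.smul_mem _ _ (Submodule.mem_span_singleton_self w), u - c • w, ?_, ?_⟩
    · simpa using h4
    · abel
  · rintro ⟨y, hy, z, hz, rfl⟩
    obtain ⟨c, rfl⟩ := Submodule.mem_span_singleton.1 hy
    intro v hv
    have hz' : A z = 0 := by simpa using hz
    rw [map_add, map_smul, hz', add_zero, real_inner_smul_left, (mem_ker_ell A w v).1 hv, mul_zero]

/-- for a bounded self-adjoint operator `A` with finite-dimensional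
kernel, `ℓ(v) = −⟨Aw,v⟩` and `a = ℓ(w) = −⟨Aw,w⟩`: (i) if `ℓ ≠ 0` and `a = 0` then the
correction term `𝔫` equals `1`; (ii) in all cases `𝔫 ≥ m⁺(a)`, where `m⁺(a) = 1` if
`a > 0` and `m⁺(a) = 0` otherwise. -/
theorem nCorrection_eq_one_and_ge (A : E →L[ℝ] E)
    (hA : ∀ u v : E, ⟪A u, v⟫ = ⟪u, A v⟫)
    (hker : FiniteDimensional ℝ (LinearMap.ker (A : E →ₗ[ℝ] E))) (w : E) :
    (ellFunctional A w ≠ 0 → -⟪A w, w⟫ = 0 → nCorrection A w = 1) ∧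
      (if 0 < -⟪A w, w⟫ then (1 : ℕ∞) else 0) ≤ nCorrection A w := by
  have hH : LinearMap.ker (A : E →ₗ[ℝ] E) ≤
      LinearMap.ker (ellFunctional A w : E →ₗ[ℝ] ℝ) := by
    intro v hv
    have hv' : A v = 0 := by simpa using hv
    rw [mem_ker_ell, hA, hv', inner_zero_right]
  unfold nCorrection
  rw [inf_eq_right.2 hH, aOrth_eq]
  constructor
  · intro hl ha
    have ha' : ⟪A w, w⟫ = 0 := by linarith
    have hAw : A w ≠ 0 := by
      intro h
      apply hl
      simp [ellFunctional, h]
    have hw0 : w ≠ 0 := by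
      rintro rfl
      simp at hAw
    have hle : Submodule.span ℝ {w} ⊔ LinearMap.ker (A : E →ₗ[ℝ] E) ≤
        LinearMap.ker (ellFunctional A w : E →ₗ[ℝ] ℝ) := by
      refine sup_le ?_ hH
      rw [Submodule.span_singleton_le_iff_mem, mem_ker_ell]
      exact ha'
    rw [inf_eq_right.2 hle]
    have hm : morseIndexOn (fun u v => ⟪A u, v⟫)
        (Submodule.span ℝ {w} ⊔ LinearMap.ker (A : E →ₗ[ℝ] E)) = 0 := by
      unfold morseIndexOn
      rw [← nonpos_iff_eq_zero]
      refine sSup_le ?_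
      rintro d ⟨W, hW, _, rfl, hneg⟩
      have : W = ⊥ := by
        rw [Submodule.eq_bot_iff]
        intro u hu
        by_contra hu0
        have h := hneg u hu hu0
        obtain ⟨y, hy, z, hz, rfl⟩ := Submodule.mem_sup.1 (hW hu)
        obtain ⟨c, rfl⟩ := Submodule.mem_span_singleton.1 hy
        have hz' : A z = 0 := by simpa using hz
        have h5 : ⟪A w, z⟫ = 0 := by rw [hA, hz', inner_zero_right]
        simp [hz', inner_add_right, real_inner_smul_left, real_inner_smul_right, ha', h5] at h
      subst this
      simp
    have hd : Submodule.span ℝ {w} ⊓ LinearMap.ker (A : E →ₗ[ℝ] E) = ⊥ := by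
      rw [Submodule.eq_bot_iff]
      rintro x ⟨hx, hx2⟩
      obtain ⟨c, rfl⟩ := Submodule.mem_span_singleton.1 hx
      have h6 : c • A w = 0 := by simpa using hx2
      rcases smul_eq_zero.1 h6 with h | h
      · simp [h]
      · exact absurd h hAw
    have hf := Submodule.finrank_sup_add_finrank_inf_eq (Submodule.span ℝ {w})
      (LinearMap.ker (A : E →ₗ[ℝ] E))
    rw [hd, finrank_bot, finrank_span_singleton hw0, add_zero] at hf
    rw [hm, hf, zero_add]
    push_cast
    exact (ENat.addLECancellable_of_ne_top (ENat.natCast_ne_top _)).add_tsub_cancel_right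
  · split_ifs with ha
    · have hw0 : w ≠ 0 := by
        rintro rfl
        simp at ha
      have hm : 1 ≤ morseIndexOn (fun u v => ⟪A u, v⟫)
          (Submodule.span ℝ {w} ⊔ LinearMap.ker (A : E →ₗ[ℝ] E)) := by
        unfold morseIndexOn
        refine le_sSup ⟨Submodule.span ℝ {w}, le_sup_left, inferInstance, ?_, ?_⟩
        · rw [finrank_span_singleton hw0]
          rfl
        · intro u hu hu0
          obtain ⟨c, rfl⟩ := Submodule.mem_span_singleton.1 hu
          have hc : c ≠ 0 := by
            rintro rfl
            simp at hu0
          have hc2 : 0 < c * c := mul_self_pos.2 hc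
          simp only [map_smul, real_inner_smul_left, real_inner_smul_right]
          nlinarith
      have hfd : FiniteDimensional ℝ
          ↥(LinearMap.ker (ellFunctional A w : E →ₗ[ℝ] ℝ) ⊓
            (Submodule.span ℝ {w} ⊔ LinearMap.ker (A : E →ₗ[ℝ] E))) :=
        Submodule.finiteDimensional_of_le inf_le_right
      have hk := Submodule.finrank_mono (le_inf hH
        (le_sup_right : _ ≤ Submodule.span ℝ {w} ⊔ LinearMap.ker (A : E →ₗ[ℝ] E)))
      refine ENat.le_sub_of_add_le_right (ENat.natCast_ne_top _) ?_
      exact add_le_add hm (by exact_mod_cast hk)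
    · exact zero_le
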